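/- Let H and G be probability measures on ℝ. Then H is a fixed point of the centred quadratic stochastic operator Q_G, i.e. Q_G(H) = H, if and only if the characteristic functions satisfy φ_H(s) = (φ_H(s/2))² · φ_G(s) for all s ∈ ℝ; in that case H is the weak limit of the iterates Q_G^n(H). -/

import Mathlib

open MeasureTheory Filter Topology

/-- The characteristic function of a finite Borel measure on `ℝ`. -/
noncomputable def charFnR (H : Measure ℝ) (s : ℝ) : ℂ :=
  ∫ x, Complex.exp (((s * x : ℝ) : ℂ) * Complex.I) ∂H

/-- The centred quadratic stochastic operator `Q_G(F) = Ḟ ∗ Ḟ ∗ G` on `ℝ`. -/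
noncomputable def cqsoR (G F : Measure ℝ) : Measure ℝ :=
  ((F.map (fun x => x / 2)).conv (F.map (fun x => x / 2))).conv G

/-- Weak convergence of a sequence of measures. -/
def WeakTendsto {E : Type*} [MeasurableSpace E] [TopologicalSpace E]
    (μ : ℕ → Measure E) (ν : Measure E) : Prop :=
  ∀ f : BoundedContinuousFunction E ℝ,
    Tendsto (fun n => ∫ x, f x ∂(μ n)) atTop (𝓝 (∫ x, f x ∂ν))

theorem charFnR_eq_charFun (H : Measure ℝ) (s : ℝ) : charFnR H s = charFun H s := by
  rw [charFun_apply_real, charFnR]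
  push_cast
  rfl

theorem charFun_cqsoR (H G : Measure ℝ) [IsProbabilityMeasure H] [IsProbabilityMeasure G]
    (s : ℝ) : charFun (cqsoR G H) s = (charFun H (s / 2)) ^ 2 * charFun G s := by
  have e : (fun x : ℝ => x / 2) = (fun x => (2 : ℝ)⁻¹ * x) := by
    funext x
    ring
  have e2 : s / 2 = 2⁻¹ * s := by ring
  rw [cqsoR, charFun_conv, charFun_conv, e, charFun_map_mul, e2, pow_two]

/-- `H` is a fixed point of `Q_G` iff `φ_H(s) = (φ_H(s/2))² φ_G(s)` for all `s`; in that case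
`H` is the weak limit of the iterates `Q_G^n(H)`. -/
theorem fixed_point_iff_charFn_eq (H G : Measure ℝ)
    [IsProbabilityMeasure H] [IsProbabilityMeasure G] :
    (cqsoR G H = H ↔
      ∀ s : ℝ, charFnR H s = (charFnR H (s / 2)) ^ 2 * charFnR G s) ∧
    (cqsoR G H = H → WeakTendsto (fun n => (cqsoR G)^[n] H) H) := by
  refine ⟨⟨fun h s => ?_, fun h => ?_⟩, fun h => ?_⟩
  · rw [charFnR_eq_charFun, charFnR_eq_charFun, charFnR_eq_charFun, ← charFun_cqsoR, h]
  · have : IsFiniteMeasure (cqsoR G H) := by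
      unfold cqsoR
      infer_instance
    apply Measure.ext_of_charFun
    funext s
    have := h s
    rw [charFnR_eq_charFun, charFnR_eq_charFun, charFnR_eq_charFun] at this
    rw [charFun_cqsoR, this]
  · intro f
    have : ∀ n, (cqsoR G)^[n] H = H := fun n => Function.iterate_fixed h n
    simp only [this]
    exact tendsto_const_nhds
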